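/- The lamplighter group L = (⨁_{ℤ} ℤ/2ℤ) ⋊ ℤ with the switch-walk-switch measure μ = μ₁ * μ₂ * μ₁ is partially noise sensitive in average distance with respect to the word metric of the symmetric generating set {(0,1), (0,−1), (δ,0)}: there exists c > 0 such that for every ρ ∈ (0,1), liminf_n E d(X_n,Y_n^ρ)/E d(X_n,X'_n) ≥ c. -/

import Mathlib

open Filter

namespace NS

/-- A probability measure on a countable (discrete) set, as a nonnegative
function summing to 1. -/
def IsProbMeasure {E : Type*} (ξ : E → ℝ) : Prop :=
  (∀ x, 0 ≤ ξ x) ∧ ∑' x, ξ x = 1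

/-- Convolution of two measures on a group. -/
noncomputable def conv {G : Type*} [Group G] (μ ν : G → ℝ) : G → ℝ :=
  fun g => ∑' h, μ h * ν (h⁻¹ * g)

/-- `convPow μ n` is the `n`-fold convolution `μ^{*n}`, the law of the random
walk at time `n` (with `μ^{*0}` the Dirac mass at the identity). -/
noncomputable def convPow {G : Type*} [Group G] (μ : G → ℝ) : ℕ → G → ℝ
  | 0 => ({1} : Set G).indicator (fun _ => (1 : ℝ))
  | n + 1 => conv μ (convPow μ n)

/-- The diagonal measure `μ^diag` on `G × G`. -/
noncomputable def diagM {G : Type*} [Group G] (μ : G → ℝ) : G × G → ℝ :=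
  {p : G × G | p.1 = p.2}.indicator (fun p => μ p.1)

/-- Product of two measures. -/
def prodM {G H : Type*} (μ : G → ℝ) (ν : H → ℝ) : G × H → ℝ :=
  fun p => μ p.1 * ν p.2

/-- The noise kernel `π^ρ = (1-ρ)·μ^diag + ρ·(μ×μ)` on `G × G`. -/
noncomputable def noise {G : Type*} [Group G] (μ : G → ℝ) (ρ : ℝ) : G × G → ℝ :=
  fun p => (1 - ρ) * diagM μ p + ρ * prodM μ μ p

/-- The `ℓ¹` distance between two measures. -/
noncomputable def l1dist {E : Type*} (ξ₁ ξ₂ : E → ℝ) : ℝ :=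
  ∑' x, |ξ₁ x - ξ₂ x|

/-- `(G,μ)` is `ℓ¹`-noise sensitive. -/
def L1NoiseSensitive {G : Type*} [Group G] (μ : G → ℝ) : Prop :=
  ∀ ρ ∈ Set.Ioo (0 : ℝ) 1,
    Tendsto
      (fun n => l1dist (convPow (noise μ ρ) n) (prodM (convPow μ n) (convPow μ n)))
      atTop (nhds 0)

/-- Shannon entropy of a measure. -/
noncomputable def entropy {E : Type*} (ξ : E → ℝ) : ℝ :=
  -∑' x, ξ x * Real.log (ξ x)

/-- `(G,μ)` is entropy noise sensitive: `H(Y_n^ρ | X_n) / H(X_n) → 1`, where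
`H(Y_n^ρ | X_n) = H(π_n^ρ) - H(μ_n)`. -/
def EntropyNoiseSensitive {G : Type*} [Group G] (μ : G → ℝ) : Prop :=
  ∀ ρ ∈ Set.Ioo (0 : ℝ) 1,
    Tendsto
      (fun n => (entropy (convPow (noise μ ρ) n) - entropy (convPow μ n))
        / entropy (convPow μ n))
      atTop (nhds 1)

/-- A function is `μ`-harmonic. -/
def Harmonic {G : Type*} [Group G] (μ : G → ℝ) (f : G → ℝ) : Prop :=
  ∀ y, f y = ∑' x, μ x * f (y * x)

/-- `(G,μ)` is Liouville: every bounded `μ`-harmonic function is constant. -/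
def Liouville {G : Type*} [Group G] (μ : G → ℝ) : Prop :=
  ∀ f : G → ℝ, Harmonic μ f → (∃ C, ∀ g, |f g| ≤ C) → ∀ x y, f x = f y

/-- Word distance for a generating set `S`: least length of a word in `S`
evaluating to `x⁻¹ * y`. -/
noncomputable def wordDist {G : Type*} [Group G] (S : Set G) (x y : G) : ℕ :=
  sInf {n : ℕ | ∃ w : List G, w.length = n ∧ (∀ g ∈ w, g ∈ S) ∧ w.prod = x⁻¹ * y}

/-- Expected distance `E d(X_n, X'_n)` between two independent samples of law `ξ`. -/
noncomputable def spread {G : Type*} [Group G] (S : Set G) (ξ : G → ℝ) : ℝ :=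
  ∑' p : G × G, ξ p.1 * ξ p.2 * (wordDist S p.1 p.2 : ℝ)

/-- Expected distance between the two coordinates under a measure on `G × G`. -/
noncomputable def avgDist {G : Type*} [Group G] (S : Set G) (π : G × G → ℝ) : ℝ :=
  ∑' p : G × G, π p * (wordDist S p.1 p.2 : ℝ)

/-- `ν` is a coupling of `ξ₁` and `ξ₂`. -/
def IsCoupling {E₁ E₂ : Type*} (ν : E₁ × E₂ → ℝ) (ξ₁ : E₁ → ℝ) (ξ₂ : E₂ → ℝ) : Prop :=
  (∀ p, 0 ≤ ν p) ∧ (∀ x, ∑' y, ν (x, y) = ξ₁ x) ∧ (∀ y, ∑' x, ν (x, y) = ξ₂ y)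

/-- `U^s(ξ₁,ξ₂)`: infimum over couplings `ν` of `ν(d(x,y) ≥ s)`. -/
noncomputable def Ufn {E₁ E₂ : Type*} (d : E₁ → E₂ → ℝ) (s : ℝ)
    (ξ₁ : E₁ → ℝ) (ξ₂ : E₂ → ℝ) : ℝ :=
  sInf {r : ℝ | ∃ ν : E₁ × E₂ → ℝ, IsCoupling ν ξ₁ ξ₂ ∧
    r = ∑' p : E₁ × E₂, {q : E₁ × E₂ | s ≤ d q.1 q.2}.indicator ν p}

/-- The `ℓ¹` product metric on `G × G` associated to the word metric of `S`. -/
noncomputable def wordDistProd {G : Type*} [Group G] (S : Set G) :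
    G × G → G × G → ℝ :=
  fun p q => (wordDist S p.1 q.1 : ℝ) + (wordDist S p.2 q.2 : ℝ)

/-- The lamp configuration group `⨁_ℤ ℤ/2ℤ` (finitely supported functions). -/
abbrev LampConf := ℤ →₀ ZMod 2

/-- The shift automorphism: `(t · f)(x) = f (x + t)`. -/
noncomputable def lampShiftAux (t : ℤ) : LampConf ≃+ LampConf :=
  Finsupp.domCongr (Equiv.subRight t)

lemma lampShiftAux_zero : lampShiftAux 0 = AddEquiv.refl LampConf :=
  AddEquiv.ext fun g => Finsupp.ext fun x => by
    simp [lampShiftAux, Finsupp.domCongr_apply]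

lemma lampShiftAux_add (s t : ℤ) :
    lampShiftAux (s + t) = (lampShiftAux t).trans (lampShiftAux s) :=
  AddEquiv.ext fun g => Finsupp.ext fun x => by
    simp [lampShiftAux, Finsupp.domCongr_apply, add_assoc]

/-- The shift action of `ℤ` on `⨁_ℤ ℤ/2ℤ`, as a homomorphism into the
automorphism group. -/
noncomputable def lampShift :
    Multiplicative ℤ →* MulAut (Multiplicative LampConf) where
  toFun t := AddEquiv.toMultiplicative (lampShiftAux t.toAdd)
  map_one' := by
    refine MulEquiv.ext fun f => ?_
    show AddEquiv.toMultiplicative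
      (lampShiftAux (Multiplicative.toAdd (1 : Multiplicative ℤ))) f = f
    rw [show Multiplicative.toAdd (1 : Multiplicative ℤ) = 0 from rfl, lampShiftAux_zero]
    rfl
  map_mul' s t := by
    refine MulEquiv.ext fun f => ?_
    show AddEquiv.toMultiplicative
      (lampShiftAux (Multiplicative.toAdd (s * t))) f = _
    rw [show Multiplicative.toAdd (s * t)
        = Multiplicative.toAdd s + Multiplicative.toAdd t from rfl, lampShiftAux_add]
    rfl

/-- The lamplighter group `L = (⨁_ℤ ℤ/2ℤ) ⋊ ℤ`. -/
abbrev Lamplighter := SemidirectProduct (Multiplicative LampConf) (Multiplicative ℤ) lampShift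

/-- The lamp switch `δ` at the origin: the configuration equal to `1` at `0`. -/
noncomputable def lampDelta : Lamplighter :=
  ⟨Multiplicative.ofAdd (Finsupp.single 0 1), 1⟩

/-- The right move `(0, 1)` of the lighter. -/
noncomputable def lampRight : Lamplighter := ⟨1, Multiplicative.ofAdd 1⟩

/-- The left move `(0, -1)` of the lighter. -/
noncomputable def lampLeft : Lamplighter := ⟨1, Multiplicative.ofAdd (-1)⟩

/-- The switch measure `μ₁`, uniform on `{(0,0), (δ,0)}`. -/
noncomputable def muSwitch : Lamplighter → ℝ :=
  fun g => ({1} : Set Lamplighter).indicator (fun _ => (1:ℝ)/2) g +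
    ({lampDelta} : Set Lamplighter).indicator (fun _ => (1:ℝ)/2) g

/-- The walk measure `μ₂`, uniform on `{(0,1), (0,-1)}`. -/
noncomputable def muWalk : Lamplighter → ℝ :=
  fun g => ({lampRight} : Set Lamplighter).indicator (fun _ => (1:ℝ)/2) g +
    ({lampLeft} : Set Lamplighter).indicator (fun _ => (1:ℝ)/2) g

/-- The switch-walk-switch measure `μ = μ₁ * μ₂ * μ₁`. -/
noncomputable def muSWS : Lamplighter → ℝ :=
  conv muSwitch (conv muWalk muSwitch)


/-! ### Finite representations of measures -/

/-- `μ` is a finite combination of Dirac masses and `E` is its expectation. -/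
def Rep {G : Type} (μ : G → ℝ) (E : (G → ℝ) → ℝ) : Prop :=
  ∃ (ι : Type) (_ : Fintype ι) (w : ι → ℝ) (g : ι → G),
    (∀ x, μ x = ∑ i, ({g i} : Set G).indicator (fun _ => w i) x) ∧
      ∀ F, E F = ∑ i, w i * F (g i)

lemma Rep.tsum_eq {G : Type} {μ : G → ℝ} {E : (G → ℝ) → ℝ} (h : Rep μ E) (F : G → ℝ) :
    ∑' x, μ x * F x = E F := by
  classical
  obtain ⟨ι, _, w, g, h1, h2⟩ := h
  have : ∀ x, μ x * F x = ∑ i, if x = g i then w i * F (g i) else 0 := by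
    intro x
    rw [h1, Finset.sum_mul]
    refine Finset.sum_congr rfl fun i _ => ?_
    by_cases hx : x = g i <;> simp [hx]
  simp_rw [this]
  rw [Summable.tsum_finsetSum, h2]
  · simp
  · intro i _
    exact (hasSum_ite_eq (g i) _).summable

lemma Rep.conv {G : Type} [Group G] {μ ν : G → ℝ} {E E' : (G → ℝ) → ℝ} (h : Rep μ E)
    (h' : Rep ν E') : Rep (conv μ ν) (fun F => E fun x => E' fun y => F (x * y)) := by
  classical
  have hc : ∀ x, NS.conv μ ν x = E fun y => ν (y⁻¹ * x) := fun x => h.tsum_eq _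
  obtain ⟨ι, _, w, g, h1, h2⟩ := h
  obtain ⟨κ, _, w', g', h1', h2'⟩ := h'
  refine ⟨ι × κ, inferInstance, fun p => w p.1 * w' p.2, fun p => g p.1 * g' p.2, ?_, ?_⟩
  · intro x
    rw [hc, h2, Fintype.sum_prod_type]
    refine Finset.sum_congr rfl fun i _ => ?_
    rw [h1', Finset.mul_sum]
    refine Finset.sum_congr rfl fun j _ => ?_
    by_cases hx : x = g i * g' j
    · simp [hx]
    · have : ¬ (g i)⁻¹ * x = g' j := fun hh => hx (by rw [← hh]; group)
      simp [hx, this]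
  · intro F
    beta_reduce
    rw [h2, Fintype.sum_prod_type]
    refine Finset.sum_congr rfl fun i _ => ?_
    rw [h2', Finset.mul_sum]
    refine Finset.sum_congr rfl fun j _ => ?_
    ring

lemma Rep.prodM {G H : Type} {μ : G → ℝ} {ν : H → ℝ} {E : (G → ℝ) → ℝ} {E' : (H → ℝ) → ℝ}
    (h : Rep μ E) (h' : Rep ν E') :
    Rep (prodM μ ν) (fun F => E fun x => E' fun y => F (x, y)) := by
  classical
  obtain ⟨ι, _, w, g, h1, h2⟩ := h
  obtain ⟨κ, _, w', g', h1', h2'⟩ := h'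
  refine ⟨ι × κ, inferInstance, fun p => w p.1 * w' p.2, fun p => (g p.1, g' p.2), ?_, ?_⟩
  · rintro ⟨x, y⟩
    rw [NS.prodM, h1, h1', Fintype.sum_prod_type, Finset.sum_mul_sum]
    refine Finset.sum_congr rfl fun i _ => Finset.sum_congr rfl fun j _ => ?_
    by_cases hx : x = g i <;> by_cases hy : y = g' j <;> simp [hx, hy]
  · intro F
    beta_reduce
    rw [h2, Fintype.sum_prod_type]
    refine Finset.sum_congr rfl fun i _ => ?_
    rw [h2', Finset.mul_sum]
    refine Finset.sum_congr rfl fun j _ => ?_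
    ring

lemma Rep.diagM {G : Type} [Group G] {μ : G → ℝ} {E : (G → ℝ) → ℝ}
    (h : Rep μ E) : Rep (diagM μ) (fun F => E fun x => F (x, x)) := by
  classical
  obtain ⟨ι, _, w, g, h1, h2⟩ := h
  refine ⟨ι, inferInstance, w, fun p => (g p, g p), ?_, fun F => h2 _⟩
  rintro ⟨x, y⟩
  by_cases hxy : x = y
  · subst hxy
    have : NS.diagM μ (x, x) = μ x := by simp [NS.diagM]
    rw [this, h1]
    refine Finset.sum_congr rfl fun i _ => ?_
    by_cases hx : x = g i <;> simp [hx]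
  · rw [Finset.sum_eq_zero]
    · simp [NS.diagM, hxy]
    · intro i _
      have : (x, y) ≠ (g i, g i) := by
        intro hh
        simp only [Prod.mk.injEq] at hh
        exact hxy (hh.1.trans hh.2.symm)
      simp [this]

lemma Rep.comb {G : Type} {μ ν : G → ℝ} {E E' : (G → ℝ) → ℝ} (a b : ℝ) (h : Rep μ E)
    (h' : Rep ν E') : Rep (fun x => a * μ x + b * ν x) (fun F => a * E F + b * E' F) := by
  classical
  obtain ⟨ι, _, w, g, h1, h2⟩ := h
  obtain ⟨κ, _, w', g', h1', h2'⟩ := h'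
  refine ⟨ι ⊕ κ, inferInstance, Sum.elim (fun i => a * w i) (fun i => b * w' i),
    Sum.elim g g', ?_, ?_⟩
  · intro x
    beta_reduce
    rw [Fintype.sum_sum_type, h1, h1', Finset.mul_sum, Finset.mul_sum]
    congr 1
    · refine Finset.sum_congr rfl fun i _ => ?_
      by_cases hx : x = g i <;> simp [hx]
    · refine Finset.sum_congr rfl fun i _ => ?_
      by_cases hx : x = g' i <;> simp [hx]
  · intro F
    simp [h2, h2', Finset.mul_sum, mul_assoc]

lemma Rep.two {G : Type} (a b : G) :
    Rep (fun g => ({a} : Set G).indicator (fun _ => (1:ℝ)/2) g +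
      ({b} : Set G).indicator (fun _ => (1:ℝ)/2) g) (fun F => (F a + F b) / 2) := by
  refine ⟨Bool, inferInstance, fun _ => 1/2, fun i => cond i a b, ?_, ?_⟩
  · intro x; simp
  · intro F; simp; ring

lemma Rep.one {G : Type} [Group G] :
    Rep (({1} : Set G).indicator (fun _ => (1:ℝ))) (fun F => F 1) :=
  ⟨Unit, inferInstance, fun _ => 1, fun _ => 1, by simp, by simp⟩

/-- iterated expectation -/
def iterE {G : Type} [Group G] (E : (G → ℝ) → ℝ) : ℕ → (G → ℝ) → ℝ
  | 0 => fun F => F 1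
  | n + 1 => fun F => E fun x => iterE E n fun y => F (x * y)

lemma Rep.convPow {G : Type} [Group G] {μ : G → ℝ} {E : (G → ℝ) → ℝ}
    (h : Rep μ E) (n : ℕ) : Rep (convPow μ n) (iterE E n) := by
  induction n with
  | zero => exact Rep.one
  | succ n ih => exact h.conv ih

/-- Basic properties of an expectation. -/
structure IsExp {G : Type} (E : (G → ℝ) → ℝ) : Prop where
  add : ∀ F F', E (fun x => F x + F' x) = E F + E F'
  smul : ∀ (a : ℝ) F, E (fun x => a * F x) = a * E F
  mono : ∀ F F', (∀ x, F x ≤ F' x) → E F ≤ E F'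
  const : ∀ a : ℝ, E (fun _ => a) = a

lemma IsExp.iter {G : Type} [Group G] {E : (G → ℝ) → ℝ} (h : IsExp E) (n : ℕ) :
    IsExp (iterE E n) := by
  induction n with
  | zero => exact ⟨fun _ _ => rfl, fun _ _ => rfl, fun F F' h => h 1, fun _ => rfl⟩
  | succ n ih =>
    refine ⟨fun F F' => ?_, fun a F => ?_, fun F F' hF => ?_, fun a => ?_⟩
    · simp only [iterE, ih.add, h.add]
    · simp only [iterE, ih.smul, h.smul]
    · exact h.mono _ _ fun x => ih.mono _ _ fun y => hF _
    · simp only [iterE, ih.const, h.const]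

lemma IsExp.sum {G : Type} {E : (G → ℝ) → ℝ} (h : IsExp E) {ι : Type} (s : Finset ι)
    (F : ι → G → ℝ) : E (fun x => ∑ i ∈ s, F i x) = ∑ i ∈ s, E (F i) := by
  classical
  induction s using Finset.induction_on with
  | empty => simpa using h.const 0
  | insert a s ha ih => simp only [Finset.sum_insert ha, h.add, ih]

lemma IsExp.abs_le {G : Type} {E : (G → ℝ) → ℝ} (h : IsExp E) (F : G → ℝ) :
    |E F| ≤ E (fun x => |F x|) := by
  rw [_root_.abs_le]
  constructor
  · have := h.mono (fun x => (-1) * |F x|) F (fun x => by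
      have := neg_abs_le (F x); linarith)
    rw [h.smul] at this
    linarith
  · exact h.mono _ _ fun x => le_abs_self _

/-! ### Lamplighter -/

abbrev L := Lamplighter

def lamp (x : L) (z : ℤ) : ZMod 2 := (Multiplicative.toAdd x.left) z
def pos (x : L) : ℤ := Multiplicative.toAdd x.right

lemma pos_mul (x y : L) : pos (x * y) = pos x + pos y := rfl
lemma pos_one : pos 1 = 0 := rfl
lemma pos_inv (x : L) : pos x⁻¹ = - pos x := rfl
lemma lamp_one (z : ℤ) : lamp 1 z = 0 := rfl
lemma lamp_mul (x y : L) (z : ℤ) : lamp (x * y) z = lamp x z + lamp y (z + pos x) := by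
  rw [lamp, SemidirectProduct.mul_left, toAdd_mul, Finsupp.add_apply]
  rfl
lemma lamp_ext {x y : L} (h1 : ∀ z, lamp x z = lamp y z) (h2 : pos x = pos y) : x = y := by
  refine SemidirectProduct.ext ?_ ?_
  · exact Multiplicative.toAdd.injective (Finsupp.ext h1)
  · exact Multiplicative.toAdd.injective h2
lemma pos_right : pos lampRight = 1 := rfl
lemma pos_left : pos lampLeft = -1 := rfl
lemma pos_delta : pos lampDelta = 0 := rfl
lemma lamp_right (z : ℤ) : lamp lampRight z = 0 := rfl
lemma lamp_left (z : ℤ) : lamp lampLeft z = 0 := rfl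
lemma lamp_delta (z : ℤ) : lamp lampDelta z = if z = 0 then 1 else 0 := by
  simp [lamp, lampDelta, Finsupp.single_apply, eq_comm]
lemma lamp_inv (x : L) (z : ℤ) : lamp x⁻¹ z = lamp x (z - pos x) := by
  have := lamp_mul x⁻¹ x z
  rw [inv_mul_cancel, lamp_one, pos_inv, ← sub_eq_add_neg] at this
  have h2 : ∀ a b : ZMod 2, 0 = a + b → a = b := by decide
  exact h2 _ _ this

/-- lamps as an explicit element -/
noncomputable def mk (f : LampConf) (t : ℤ) : L := ⟨Multiplicative.ofAdd f, Multiplicative.ofAdd t⟩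
lemma lamp_mk (f t z) : lamp (mk f t) z = f z := rfl
lemma pos_mk (f t) : pos (mk f t) = t := rfl

/-! ### Expectations -/

noncomputable def Sw (F : L → ℝ) : ℝ := (F 1 + F lampDelta) / 2
noncomputable def Wk (F : L → ℝ) : ℝ := (F lampRight + F lampLeft) / 2
noncomputable def Emu (F : L → ℝ) : ℝ :=
  Sw fun x => Wk fun y => Sw fun z => F (x * (y * z))
noncomputable def Eno (ρ : ℝ) (F : L × L → ℝ) : ℝ :=
  (1 - ρ) * Emu (fun x => F (x, x)) + ρ * Emu (fun x => Emu fun y => F (x, y))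

lemma rep_mu : Rep muSWS Emu := by
  have hs : Rep muSwitch Sw := Rep.two _ _
  have hw : Rep muWalk Wk := Rep.two _ _
  exact Rep.conv (E := Sw) (E' := fun F => Wk fun y => Sw fun z => F (y * z)) hs (hw.conv hs)

lemma rep_noise (ρ : ℝ) : Rep (noise muSWS ρ) (Eno ρ) :=
  Rep.comb _ _ rep_mu.diagM (rep_mu.prodM rep_mu)

lemma exp_mu : IsExp Emu := by
  refine ⟨fun F F' => ?_, fun a F => ?_, fun F F' hF => ?_, fun a => ?_⟩
  · simp only [Emu, Sw, Wk]; ring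
  · simp only [Emu, Sw, Wk]; ring
  · simp only [Emu, Sw, Wk]; gcongr <;> exact hF _
  · simp only [Emu, Sw, Wk]; ring

lemma exp_no {ρ : ℝ} (h0 : 0 ≤ ρ) (h1 : ρ ≤ 1) : IsExp (Eno ρ) := by
  refine ⟨fun F F' => ?_, fun a F => ?_, fun F F' hF => ?_, fun a => ?_⟩
  · simp only [Eno, exp_mu.add]; ring
  · simp only [Eno, exp_mu.smul]; ring
  · have h2 : 0 ≤ 1 - ρ := by linarith
    exact add_le_add
      (mul_le_mul_of_nonneg_left (exp_mu.mono _ _ fun x => hF _) h2)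
      (mul_le_mul_of_nonneg_left (exp_mu.mono _ _ fun x => exp_mu.mono _ _ fun y => hF _) h0)
  · simp only [Eno, exp_mu.const]; ring

lemma Emu_pos (G : ℤ → ℝ) : Emu (fun x => G (pos x)) = (G 1 + G (-1)) / 2 := by
  simp only [Emu, Sw, Wk, pos_mul, pos_one, pos_delta, pos_right, pos_left]
  norm_num

lemma Emu_odd (K : L → ℝ) (h : ∀ x, K (lampDelta * x) = - K x) : Emu K = 0 := by
  simp only [Emu, Sw, Wk, h, one_mul]; ring

/-- Exchange of expectations. -/
lemma IsExp.swap {G : Type} {E : (G → ℝ) → ℝ} (h : IsExp E) (F : G → L → ℝ) :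
    E (fun x => Emu fun y => F x y) = Emu fun y => E fun x => F x y := by
  have : ∀ u : ℝ, u / 2 = (2:ℝ)⁻¹ * u := fun u => by ring
  simp only [Emu, Sw, Wk, this, h.add, h.smul]

lemma iter_one (n : ℕ) (F : L × L → ℝ) :
    iterE (Eno 1) n F = iterE Emu n fun x => iterE Emu n fun y => F (x, y) := by
  induction n generalizing F with
  | zero => rfl
  | succ n ih =>
    simp only [iterE, Eno, ih, (exp_mu.iter n).swap]
    simp [Prod.mk_mul_mk]

lemma iter_fst (ρ : ℝ) (n : ℕ) (F : L → ℝ) :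
    iterE (Eno ρ) n (fun p => F p.1) = iterE Emu n F := by
  induction n generalizing F with
  | zero => rfl
  | succ n ih =>
    have : ∀ x : L × L, iterE (Eno ρ) n (fun y => F (x * y).1) = iterE Emu n fun y => F (x.1 * y) :=
      fun x => ih (fun y => F (x.1 * y))
    simp only [iterE, this, Eno, exp_mu.const]
    ring

lemma iter_snd (ρ : ℝ) (n : ℕ) (F : L → ℝ) :
    iterE (Eno ρ) n (fun p => F p.2) = iterE Emu n F := by
  induction n generalizing F with
  | zero => rfl
  | succ n ih =>
    have : ∀ x : L × L, iterE (Eno ρ) n (fun y => F (x * y).2) = iterE Emu n fun y => F (x.2 * y) :=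
      fun x => ih (fun y => F (x.2 * y))
    simp only [iterE, this, Eno, exp_mu.const]
    ring

/-! ### Word metric -/

def S : Set L := {lampRight, lampLeft, lampDelta}

/-- `g` is a word of length `n` -/
def Wd (g : L) (n : ℕ) : Prop := ∃ w : List L, w.length = n ∧ (∀ h ∈ w, h ∈ S) ∧ w.prod = g

lemma Wd.mul {g h : L} {m n : ℕ} (hg : Wd g m) (hh : Wd h n) : Wd (g * h) (m + n) := by
  obtain ⟨w, rfl, h2, rfl⟩ := hg
  obtain ⟨w', rfl, h2', rfl⟩ := hh
  refine ⟨w ++ w', by simp, ?_, by simp⟩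
  intro x hx
  rcases List.mem_append.1 hx with hx | hx
  exacts [h2 _ hx, h2' _ hx]

lemma Wd.one : Wd 1 0 := ⟨[], rfl, by simp, rfl⟩
lemma Wd.gen {g : L} (h : g ∈ S) : Wd g 1 := ⟨[g], rfl, by simpa using h, by simp⟩

lemma S_inv {g : L} (h : g ∈ S) : g⁻¹ ∈ S := by
  rcases h with rfl | rfl | rfl
  · right; left
    exact inv_eq_of_mul_eq_one_right (lamp_ext (by simp [lamp_mul, lamp_right, lamp_left, lamp_one]) rfl)
  · left
    exact inv_eq_of_mul_eq_one_right (lamp_ext (by simp [lamp_mul, lamp_right, lamp_left, lamp_one]) rfl)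
  · right; right
    refine inv_eq_of_mul_eq_one_right (lamp_ext (fun z => ?_) rfl)
    simp only [lamp_mul, lamp_delta, pos_delta, add_zero, lamp_one]
    split_ifs <;> decide

lemma Wd.inv {g : L} {n : ℕ} (h : Wd g n) : Wd g⁻¹ n := by
  obtain ⟨w, rfl, h2, rfl⟩ := h
  induction w with
  | nil => simpa using Wd.one
  | cons a w ih =>
    have := (ih fun h hh => h2 h (List.mem_cons_of_mem _ hh)).mul
      (Wd.gen (S_inv (h2 a List.mem_cons_self)))
    simpa using this

noncomputable def shiftEl (t : ℤ) : L := mk 0 t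

lemma Wd.shift (t : ℤ) : Wd (shiftEl t) t.natAbs := by
  have key : ∀ n : ℕ, Wd (shiftEl n) n := by
    intro n
    induction n with
    | zero => exact Wd.one
    | succ n ih =>
      have := ih.mul (Wd.gen (g := lampRight) (Or.inl rfl))
      convert this using 1
      refine lamp_ext (fun z => ?_) ?_
      · simp [shiftEl, lamp_mul, lamp_mk, lamp_right]
      · simp [shiftEl, pos_mul, pos_mk, pos_right]
  rcases Int.natAbs_eq t with h | h
  · have := key t.natAbs
    rwa [← h] at this
  · have := (key t.natAbs).inv
    convert this using 1
    refine lamp_ext (fun z => ?_) ?_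
    · simp [shiftEl, lamp_inv, lamp_mk]
    · simp only [shiftEl, pos_inv, pos_mk]; exact h

lemma Wd.row (k : ℕ) : ∀ f : LampConf, (∀ z, f z ≠ 0 → -(k:ℤ) < z ∧ z ≤ 0) →
    ∃ n ≤ 2 * k, Wd (mk f k) n := by
  induction k with
  | zero =>
    intro f hf
    refine ⟨0, le_rfl, ?_⟩
    convert Wd.one using 1
    refine lamp_ext (fun z => ?_) rfl
    rw [lamp_mk, lamp_one]
    by_contra h
    have := hf z h
    push_cast at this
    omega
  | succ k ih =>
    intro f hf
    obtain ⟨n, hn, hw⟩ := ih (f.erase (-(k:ℤ))) (by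
      intro z hz
      by_cases h : z = -(k:ℤ)
      · simp [h] at hz
      · rw [Finsupp.erase_ne h] at hz
        have := hf z hz
        push_cast at this
        omega)
    by_cases h0 : f (-(k:ℤ)) = 0
    · refine ⟨n + 1, by omega, ?_⟩
      have := hw.mul (Wd.gen (g := lampRight) (Or.inl rfl))
      convert this using 1
      refine lamp_ext (fun z => ?_) ?_
      · rw [lamp_mul, lamp_mk, lamp_mk, lamp_right, add_zero]
        by_cases h : z = -(k:ℤ)
        · rw [h, h0]; simp
        · rw [Finsupp.erase_ne h]
      · simp [pos_mul, pos_mk, pos_right]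
    · refine ⟨n + 1 + 1, by omega, ?_⟩
      have := (hw.mul (Wd.gen (g := lampDelta) (Or.inr (Or.inr rfl)))).mul
        (Wd.gen (g := lampRight) (Or.inl rfl))
      convert this using 1
      refine lamp_ext (fun z => ?_) ?_
      · rw [lamp_mul, lamp_mul, lamp_mk, lamp_mk, lamp_right, add_zero, pos_mk, lamp_delta]
        by_cases h : z = -(k:ℤ)
        · have h2 : ∀ a : ZMod 2, a ≠ 0 → a = 1 := by decide
          rw [h, h2 _ h0]; simp
        · rw [Finsupp.erase_ne h, if_neg (by omega), add_zero]
      · simp [pos_mul, pos_mk, pos_right, pos_delta]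

/-- all lamps and the position are within radius `m` -/
def Rad (x : L) (m : ℕ) : Prop := |pos x| ≤ m ∧ ∀ z, lamp x z ≠ 0 → |z| ≤ m

lemma Rad.word {x : L} {m : ℕ} (h : Rad x m) : ∃ n ≤ 7 * m + 3, Wd x n := by
  obtain ⟨n, hn, hw⟩ := Wd.row (2 * m + 1)
    (Finsupp.domCongr (Equiv.subRight (m:ℤ)) (Multiplicative.toAdd x.left)) (by
      intro z hz
      have : lamp x (z + m) ≠ 0 := hz
      have := h.2 _ this
      rw [abs_le] at this
      push_cast
      omega)
  have hp := h.1
  rw [abs_le] at hp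
  have hh := ((Wd.shift (-m)).mul hw).mul (Wd.shift (pos x - m - 1))
  refine ⟨(-(m:ℤ)).natAbs + n + (pos x - m - 1).natAbs, ?_, ?_⟩
  · omega
  · convert hh using 1
    refine lamp_ext (fun z => ?_) ?_
    · rw [lamp_mul, lamp_mul]
      simp only [shiftEl, lamp_mk, pos_mk, Finsupp.coe_zero, Pi.zero_apply, zero_add, add_zero]
      show _ = lamp x (z + -m + m)
      congr 1; ring
    · simp only [shiftEl, pos_mul, pos_mk]; push_cast; ring

lemma exists_rad (x : L) : ∃ m, Rad x m := by
  refine ⟨(pos x).natAbs + ∑ z ∈ (Multiplicative.toAdd x.left).support, z.natAbs, ?_, ?_⟩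
  · push_cast
    have : 0 ≤ ∑ z ∈ (Multiplicative.toAdd x.left).support, |z| :=
      Finset.sum_nonneg fun _ _ => abs_nonneg _
    linarith
  · intro z hz
    push_cast
    have : |z| ≤ ∑ z ∈ (Multiplicative.toAdd x.left).support, |z| :=
      Finset.single_le_sum (f := fun z : ℤ => |z|) (fun _ _ => abs_nonneg _) (Finsupp.mem_support_iff.2 hz)
    have := abs_nonneg (pos x)
    linarith

noncomputable def len (x : L) : ℕ := sInf {n : ℕ | Wd x n}

lemma len_spec (x : L) : Wd x (len x) := by
  obtain ⟨m, hm⟩ := exists_rad x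
  obtain ⟨n, _, hn⟩ := hm.word
  exact Nat.sInf_mem (s := {n : ℕ | Wd x n}) ⟨n, hn⟩

lemma len_le {x : L} {n : ℕ} (h : Wd x n) : len x ≤ n := Nat.sInf_le h

lemma wordDist_eq (x y : L) : wordDist S x y = len (x⁻¹ * y) := rfl

lemma wordDist_le (x y : L) : wordDist S x y ≤ len x + len y :=
  len_le ((len_spec x).inv.mul (len_spec y))

lemma card_supp_le (w : List L) (hw : ∀ g ∈ w, g ∈ S) (s : Finset ℤ)
    (hs : ∀ z ∈ s, lamp w.prod z ≠ 0) : s.card ≤ w.length := by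
  induction w generalizing s with
  | nil =>
    have : s = ∅ := Finset.eq_empty_of_forall_notMem fun z hz => hs z hz (by simp [lamp_one])
    simp [this]
  | cons a w ih =>
    have ih := ih (fun g hg => hw g (List.mem_cons_of_mem _ hg))
    have h1 := ih ((s.erase 0).map (addRightEmbedding (pos a))) (by
      intro z hz
      obtain ⟨y, hy, rfl⟩ := Finset.mem_map.1 hz
      obtain ⟨hy0, hy⟩ := Finset.mem_erase.1 hy
      have := hs y hy
      rw [List.prod_cons, lamp_mul] at this
      have h3 : lamp a y = 0 := by
        rcases hw a List.mem_cons_self with rfl | rfl | rfl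
        · rfl
        · rfl
        · simp [lamp_delta, hy0]
      rwa [h3, zero_add] at this)
    rw [Finset.card_map] at h1
    have := Finset.pred_card_le_card_erase (s := s) (a := 0)
    rw [List.length_cons]
    omega

lemma le_wordDist (x y : L) (s : Finset ℤ) (hs : ∀ z ∈ s, lamp x z ≠ lamp y z) :
    s.card ≤ wordDist S x y := by
  rw [wordDist_eq]
  obtain ⟨w, h1, h2, h3⟩ := len_spec (x⁻¹ * y)
  rw [← h1]
  have := card_supp_le w h2 (s.map (addRightEmbedding (pos x))) (by
    intro z hz
    obtain ⟨u, hu, rfl⟩ := Finset.mem_map.1 hz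
    rw [h3, lamp_mul, lamp_inv, pos_inv]
    simp only [addRightEmbedding_apply, add_sub_cancel_right, add_neg_cancel_right]
    have h4 : ∀ a b : ZMod 2, a ≠ b → a + b ≠ 0 := by decide
    exact h4 _ _ (hs u hu))
  rwa [Finset.card_map] at this


/-! ### Upper bound -/

/-- properties of a single step -/
def Stp (h : L) : Prop :=
  (pos h = 1 ∨ pos h = -1) ∧ ∀ z, lamp h z ≠ 0 → z = 0 ∨ z = -pos h

lemma stp_mk (a y b : L) (ha : a = 1 ∨ a = lampDelta) (hy : y = lampRight ∨ y = lampLeft)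
    (hb : b = 1 ∨ b = lampDelta) : Stp (a * (y * b)) := by
  have h1 : ∀ a : L, (a = 1 ∨ a = lampDelta) → pos a = 0 ∧ ∀ z, z ≠ 0 → lamp a z = 0 := by
    rintro a (rfl | rfl)
    · exact ⟨rfl, fun _ _ => rfl⟩
    · exact ⟨rfl, fun z hz => by simp [lamp_delta, hz]⟩
  have h2 : (pos y = 1 ∨ pos y = -1) ∧ ∀ z, lamp y z = 0 := by
    rcases hy with rfl | rfl
    · exact ⟨Or.inl rfl, fun _ => rfl⟩
    · exact ⟨Or.inr rfl, fun _ => rfl⟩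
  obtain ⟨ha1, ha2⟩ := h1 a ha
  obtain ⟨hb1, hb2⟩ := h1 b hb
  refine ⟨by simpa [pos_mul, ha1, hb1] using h2.1, fun z hz => ?_⟩
  by_contra hcon
  push Not at hcon
  apply hz
  simp only [pos_mul, ha1, hb1, zero_add, add_zero] at hcon
  rw [lamp_mul, lamp_mul, ha2 z hcon.1, h2.2, hb2]
  · simp
  · rw [ha1]; intro h; apply hcon.2; linarith

lemma Emu_le (K : L → ℝ) (U : ℤ → ℝ) (h : ∀ x, Stp x → K x ≤ U (pos x)) :
    Emu K ≤ (U 1 + U (-1)) / 2 := by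
  rw [← Emu_pos]
  have h1 : ∀ a y b : L, (a = 1 ∨ a = lampDelta) → (y = lampRight ∨ y = lampLeft) →
      (b = 1 ∨ b = lampDelta) → K (a * (y * b)) ≤ U (pos (a * (y * b))) :=
    fun a y b ha hy hb => h _ (stp_mk a y b ha hy hb)
  simp only [Emu, Sw, Wk]
  gcongr <;> apply h1 <;> simp

/-- potential -/
def Psi (s m : ℤ) : ℤ := s ^ 2 + (m - |s|) ^ 2

lemma Psi_step (s m : ℤ) (h : |s| ≤ m) :
    Psi (s + 1) (max m |s + 1|) + Psi (s - 1) (max m |s - 1|) ≤ 2 * Psi s m + 4 := by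
  unfold Psi
  rcases lt_trichotomy s 0 with hs | hs | hs
  · rw [abs_of_neg hs] at *
    rw [abs_of_nonpos (by omega : s + 1 ≤ 0), abs_of_neg (by omega : s - 1 < 0),
      max_eq_left (by omega : -(s+1) ≤ m)]
    rcases le_or_gt (-(s - 1)) m with h1 | h1
    · rw [max_eq_left h1]; nlinarith
    · rw [max_eq_right h1.le]
      obtain rfl : m = -s := by omega
      nlinarith
  · subst hs
    simp only [abs_zero] at h
    norm_num
    rcases le_or_gt 1 m with h1 | h1
    · rw [max_eq_left h1]; nlinarith
    · obtain rfl : m = 0 := by omega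
      norm_num
  · rw [abs_of_pos hs] at *
    rw [abs_of_nonneg (by omega : 0 ≤ s - 1), abs_of_pos (by omega : 0 < s + 1),
      max_eq_left (by omega : s - 1 ≤ m)]
    rcases le_or_gt (s + 1) m with h1 | h1
    · rw [max_eq_left h1]; nlinarith
    · rw [max_eq_right h1.le]
      obtain rfl : m = s := by omega
      nlinarith

lemma Rad.step {x h : L} {m : ℕ} (hx : Rad x m) (hh : Stp h) :
    Rad (x * h) (max m (pos x + pos h).natAbs) := by
  constructor
  · rw [pos_mul]; push_cast; exact le_max_right _ _
  · intro z hz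
    push_cast
    rw [lamp_mul] at hz
    by_cases h1 : lamp x z = 0
    · rw [h1, zero_add] at hz
      rcases hh.2 _ hz with h2 | h2
      · refine le_trans ?_ (le_max_left _ _)
        rw [show z = - pos x by linarith, abs_neg]; exact hx.1
      · refine le_trans ?_ (le_max_right _ _)
        rw [show z = - (pos x + pos h) by linarith, abs_neg]
    · exact (hx.2 z h1).trans (le_max_left _ _)

lemma iter_le (F : L → ℝ) (α β : ℝ) (hβ : 0 ≤ β)
    (hF : ∀ x m, Rad x m → F x ≤ α + β * Psi (pos x) m) (n : ℕ) :
    ∀ x m, Rad x m → iterE Emu n (fun y => F (x * y)) ≤ α + β * (Psi (pos x) m + 2 * n) := by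
  induction n with
  | zero =>
    intro x m h
    simpa [iterE] using hF x m h
  | succ n ih =>
    intro x m h
    simp only [iterE]
    simp only [← mul_assoc x]
    have := Emu_le (fun h => iterE Emu n fun y => F (x * h * y))
      (fun t => α + β * (Psi (pos x + t) (max m |pos x + t|) + 2 * n)) (by
        intro k hk
        have := ih (x * k) _ (h.step hk)
        rw [pos_mul] at this
        push_cast at this
        convert this using 4)
    refine this.trans ?_
    have h2 := Psi_step (pos x) m h.1
    have h3 : ((Psi (pos x + 1) (max m |pos x + 1|) : ℤ) : ℝ)
        + (Psi (pos x + -1) (max m |pos x + -1|) : ℤ) ≤ 2 * (Psi (pos x) m : ℤ) + 4 := by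
      rw [← sub_eq_add_neg]
      exact_mod_cast h2
    push_cast
    nlinarith [mul_le_mul_of_nonneg_left h3 hβ]

lemma rad_one : Rad 1 0 := ⟨by simp [pos_one], fun z hz => absurd (lamp_one z) hz⟩

lemma iter_len_le (n : ℕ) (hn : 1 ≤ n) :
    iterE Emu n (fun y => (len y : ℝ)) ≤ 21 * √n := by
  have hn' : (1:ℝ) ≤ n := by exact_mod_cast hn
  have hq : (1:ℝ) ≤ √n := Real.one_le_sqrt.2 hn'
  have hq2 : √(n:ℝ) * √n = n := Real.mul_self_sqrt (by linarith)
  set q := √(n:ℝ)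
  have hq0 : 0 < q := by linarith
  have := iter_le (fun x => (len x : ℝ)) (3 + 7 / 2 * q) (7 / q) (by positivity) (by
    intro x m h
    obtain ⟨k, hk, hw⟩ := h.word
    have h1 : (len x : ℝ) ≤ 7 * m + 3 := by exact_mod_cast (len_le hw).trans hk
    have h2 : (m:ℤ) ^ 2 ≤ 2 * Psi (pos x) m := by
      unfold Psi
      have := sq_abs (pos x)
      nlinarith [sq_nonneg ((m:ℤ) - 2 * |pos x|)]
    have h3 : (m:ℝ) ^ 2 ≤ 2 * (Psi (pos x) m : ℤ) := by exact_mod_cast h2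
    have h4 : 7 * (m:ℝ) ≤ 7 / 2 * q + 7 / q * (Psi (pos x) m : ℤ) := by
      have : 7 / 2 * q + 7 / q * ((Psi (pos x) m : ℤ) : ℝ) - 7 * m
          = 7 / (2 * q) * (q ^ 2 + 2 * (Psi (pos x) m : ℤ) - 2 * q * m) := by
        field_simp
      have h5 : 0 ≤ 7 / (2 * q) * (q ^ 2 + 2 * ((Psi (pos x) m : ℤ) : ℝ) - 2 * q * m) := by
        apply mul_nonneg (by positivity)
        nlinarith [sq_nonneg (q - m)]
      linarith
    linarith) n 1 0 rad_one
  simp only [one_mul] at this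
  have h0 : Psi (pos 1) ((0:ℕ):ℤ) = 0 := by simp [Psi, pos_one]
  rw [h0] at this
  have h6 : 7 / q * (((0:ℤ):ℝ) + 2 * n) = 14 * q := by
    rw [← hq2]; field_simp; push_cast; ring
  rw [h6] at this
  linarith

lemma upper {ρ : ℝ} (h0 : 0 ≤ ρ) (h1 : ρ ≤ 1) (n : ℕ) (hn : 1 ≤ n) :
    iterE (Eno ρ) n (fun p => (wordDist S p.1 p.2 : ℝ)) ≤ 42 * √n := by
  have hE := (exp_no h0 h1).iter n
  have := hE.mono (fun p => (wordDist S p.1 p.2 : ℝ)) (fun p => (len p.1 : ℝ) + len p.2)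
    (fun p => by exact_mod_cast wordDist_le p.1 p.2)
  rw [hE.add, iter_fst ρ n (fun x => (len x : ℝ)), iter_snd ρ n (fun x => (len x : ℝ))] at this
  linarith [iter_len_le n hn]

/-! ### Lower bound -/

def chi (a : ZMod 2) : ℝ := if a = 0 then 1 else -1

lemma chi_add (a b : ZMod 2) : chi (a + b) = chi a * chi b := by
  have h : ∀ a : ZMod 2, a = 0 ∨ a = 1 := by decide
  have h2 : (1 + 1 : ZMod 2) = 0 := by decide
  rcases h a with rfl | rfl <;> rcases h b with rfl | rfl <;> simp [chi, h2]

lemma abs_chi (a : ZMod 2) : |chi a| = 1 := by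
  unfold chi; split_ifs <;> simp

/-- survival function of the walk killed at `0` with probability `ρ` -/
noncomputable def B (ρ : ℝ) : ℕ → ℤ → ℝ
  | 0 => fun _ => 1
  | n + 1 => fun z => (1 - if z = 0 then ρ else 0) * ((B ρ n (z + 1) + B ρ n (z + -1)) / 2)

lemma B_nonneg {ρ : ℝ} (h0 : 0 ≤ ρ) (h1 : ρ ≤ 1) (n : ℕ) (z : ℤ) : 0 ≤ B ρ n z := by
  induction n generalizing z with
  | zero => simp [B]
  | succ n ih =>
    have a := ih (z + 1)
    have b := ih (z + -1)
    simp only [B]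
    apply mul_nonneg
    · split_ifs <;> linarith
    · linarith

lemma A_bound {ρ : ℝ} (h0 : 0 ≤ ρ) (h1 : ρ ≤ 1) (n : ℕ) : ∀ (z w : ℤ),
    |iterE (Eno ρ) n (fun p => chi (lamp p.1 z) * chi (lamp p.2 w))| ≤ B ρ n z := by
  have hρ : 0 ≤ 1 - ρ := by linarith
  induction n with
  | zero => intro z w; simp [iterE, B, lamp_one, chi]
  | succ n ih =>
    intro z w
    set A : ℤ → ℤ → ℝ := fun z w => iterE (Eno ρ) n (fun p => chi (lamp p.1 z) * chi (lamp p.2 w))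
      with hA
    set K : L × L → ℝ := fun h => chi (lamp h.1 z) * chi (lamp h.2 w) *
      A (z + pos h.1) (w + pos h.2) with hK
    have hstep : iterE (Eno ρ) (n + 1) (fun p => chi (lamp p.1 z) * chi (lamp p.2 w))
        = Eno ρ K := by
      simp only [iterE]
      congr 1
      funext h
      rw [hK, hA]
      beta_reduce
      rw [← ((exp_no h0 h1).iter n).smul]
      congr 1
      funext y
      rw [Prod.fst_mul, Prod.snd_mul, lamp_mul, lamp_mul, chi_add, chi_add]
      ring
    have hKb : ∀ x y, |K (x, y)| ≤ B ρ n (z + pos x) := by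
      intro x y
      rw [hK]
      simp only [abs_mul, abs_chi, one_mul]
      exact ih _ _
    have hP : Emu (fun x => B ρ n (z + pos x)) = (B ρ n (z + 1) + B ρ n (z + -1)) / 2 :=
      Emu_pos (fun t => B ρ n (z + t))
    have hd : |Emu fun x => K (x, x)| ≤ (B ρ n (z + 1) + B ρ n (z + -1)) / 2 := by
      rw [← hP]
      exact (exp_mu.abs_le _).trans (exp_mu.mono _ _ fun x => hKb x x)
    have hp : |Emu fun x => Emu fun y => K (x, y)| ≤ (B ρ n (z + 1) + B ρ n (z + -1)) / 2 := by
      rw [← hP]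
      refine (exp_mu.abs_le _).trans (exp_mu.mono _ _ fun x => ?_)
      refine (exp_mu.abs_le _).trans ?_
      refine (exp_mu.mono _ _ fun y => hKb x y).trans ?_
      rw [exp_mu.const]
    have hz : z = 0 → (Emu fun x => Emu fun y => K (x, y)) = 0 := by
      rintro rfl
      apply Emu_odd
      intro x
      have : ∀ y, K (lampDelta * x, y) = (-1) * K (x, y) := by
        intro y
        simp only [hK, lamp_mul, pos_mul, pos_delta, lamp_delta, chi_add, zero_add, if_true]
        simp [chi]
      simp only [this, exp_mu.smul]
      ring
    rw [hstep, Eno]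
    refine (abs_add_le _ _).trans ?_
    rw [abs_mul, abs_mul, abs_of_nonneg h0, abs_of_nonneg hρ]
    simp only [B]
    by_cases h : z = 0
    · rw [hz h, if_pos h, abs_zero, mul_zero, add_zero]
      exact mul_le_mul_of_nonneg_left hd hρ
    · rw [if_neg h]
      nlinarith [mul_le_mul_of_nonneg_left hd hρ, mul_le_mul_of_nonneg_left hp h0]

/-- killing probability -/
noncomputable def Q (ρ : ℝ) (n : ℕ) (z : ℤ) : ℝ := 1 - B ρ n z

noncomputable def sk (ρ : ℝ) (n : ℕ) : ℝ := ρ * ((B ρ n 1 + B ρ n (-1)) / 2)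

lemma Q_succ (ρ : ℝ) (n : ℕ) (z : ℤ) :
    Q ρ (n + 1) z = (Q ρ n (z + 1) + Q ρ n (z - 1)) / 2 + if z = 0 then sk ρ n else 0 := by
  simp only [Q, B, sk, sub_eq_add_neg z]
  split_ifs with h
  · subst h; simp only [zero_add]; ring
  · ring

lemma Q_supp (ρ : ℝ) (n : ℕ) (z : ℤ) (h : (n:ℤ) ≤ |z|) : Q ρ n z = 0 := by
  induction n generalizing z with
  | zero => simp [Q, B]
  | succ n ih =>
    push_cast at h
    have hz : z ≠ 0 := by
      rintro rfl
      rw [abs_zero] at h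
      omega
    rw [Q_succ, if_neg hz, ih, ih]
    · simp
    · have := abs_sub_abs_le_abs_sub z 1
      norm_num at this
      linarith
    · have := abs_sub_abs_le_abs_sub z (-1)
      norm_num at this
      linarith

noncomputable def I (ρ : ℝ) (n : ℕ) (φ : ℤ → ℝ) : ℝ := ∑' z, Q ρ n z * φ z

lemma Q_summable (ρ : ℝ) (n : ℕ) (φ : ℤ → ℝ) : Summable fun z => Q ρ n z * φ z := by
  apply summable_of_ne_finset_zero (s := Finset.Icc (-(n:ℤ)) n)
  intro z hz
  rw [Q_supp, zero_mul]
  by_contra h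
  push Not at h
  rw [abs_lt] at h
  exact hz (Finset.mem_Icc.2 ⟨h.1.le, h.2.le⟩)

lemma I_succ (ρ : ℝ) (n : ℕ) (φ : ℤ → ℝ) :
    I ρ (n + 1) φ = I ρ n (fun z => (φ (z + 1) + φ (z - 1)) / 2) + sk ρ n * φ 0 := by
  have e1 : HasSum (fun z => Q ρ n (z + 1) * φ z) (I ρ n fun z => φ (z - 1)) := by
    have := (Q_summable ρ n fun z => φ (z - 1)).hasSum
    rw [← (Equiv.addRight (1:ℤ)).hasSum_iff] at this
    simpa [Function.comp_def, I] using this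
  have e2 : HasSum (fun z => Q ρ n (z - 1) * φ z) (I ρ n fun z => φ (z + 1)) := by
    have := (Q_summable ρ n fun z => φ (z + 1)).hasSum
    rw [← (Equiv.subRight (1:ℤ)).hasSum_iff] at this
    simpa [Function.comp_def, I] using this
  have e3 : HasSum (fun z : ℤ => if z = 0 then sk ρ n * φ 0 else 0) (sk ρ n * φ 0) :=
    hasSum_ite_eq 0 _
  have e4 := ((e1.add e2).div_const 2).add e3
  have e5 : HasSum (fun z => Q ρ n z * ((φ (z + 1) + φ (z - 1)) / 2))
      ((I ρ n (fun z => φ (z + 1)) + I ρ n fun z => φ (z - 1)) / 2) := by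
    have := (((Q_summable ρ n fun z => φ (z + 1)).hasSum).add
      ((Q_summable ρ n fun z => φ (z - 1)).hasSum)).div_const 2
    have hf : (fun z => Q ρ n z * ((φ (z + 1) + φ (z - 1)) / 2)) =
        fun z => (Q ρ n z * φ (z + 1) + Q ρ n z * φ (z - 1)) / 2 := by
      funext z; ring
    rw [hf]
    exact this
  rw [I, I, e5.tsum_eq]
  have e6 : (fun z => Q ρ (n + 1) z * φ z) = fun z =>
      (Q ρ n (z + 1) * φ z + Q ρ n (z - 1) * φ z) / 2 + if z = 0 then sk ρ n * φ 0 else 0 := by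
    funext z
    rw [Q_succ]
    split_ifs with h
    · subst h; ring
    · ring
  rw [e6, e4.tsum_eq]
  ring

lemma I_add (ρ : ℝ) (n : ℕ) (φ ψ : ℤ → ℝ) :
    I ρ n (fun z => φ z + ψ z) = I ρ n φ + I ρ n ψ := by
  simp only [I, mul_add]
  exact (Q_summable ρ n φ).tsum_add (Q_summable ρ n ψ)

lemma I_smul (ρ : ℝ) (n : ℕ) (a : ℝ) (φ : ℤ → ℝ) :
    I ρ n (fun z => a * φ z) = a * I ρ n φ := by
  simp only [I, ← tsum_mul_left]
  congr 1; funext z; ring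

lemma I_zero (ρ : ℝ) (φ : ℤ → ℝ) : I ρ 0 φ = 0 := by simp [I, Q, B]

section
variable {ρ : ℝ}

lemma sk_nonneg (h0 : 0 < ρ) (h1 : ρ ≤ 1) (n : ℕ) : 0 ≤ sk ρ n := by
  have a := B_nonneg h0.le h1 n 1
  have b := B_nonneg h0.le h1 n (-1)
  unfold sk
  positivity

lemma Q_nonneg (h0 : 0 < ρ) (h1 : ρ ≤ 1) (n : ℕ) (z : ℤ) : 0 ≤ Q ρ n z := by
  induction n generalizing z with
  | zero => simp [Q, B]
  | succ n ih =>
    rw [Q_succ]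
    have a := ih (z + 1)
    have b := ih (z - 1)
    have c := sk_nonneg h0 h1 n
    split_ifs <;> linarith

lemma I_mono (h0 : 0 < ρ) (h1 : ρ ≤ 1) (n : ℕ) {φ ψ : ℤ → ℝ} (h : ∀ z, φ z ≤ ψ z) :
    I ρ n φ ≤ I ρ n ψ :=
  (Q_summable ρ n φ).tsum_le_tsum
    (fun z => mul_le_mul_of_nonneg_left (h z) (Q_nonneg h0 h1 n z)) (Q_summable ρ n ψ)

lemma T_succ (n : ℕ) : I ρ (n + 1) (fun _ => 1) = I ρ n (fun _ => 1) + sk ρ n := by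
  rw [I_succ]; norm_num

lemma V_succ (n : ℕ) : I ρ (n + 1) (fun z => (z:ℝ) ^ 2)
    = I ρ n (fun z => (z:ℝ) ^ 2) + I ρ n (fun _ => 1) := by
  rw [I_succ, ← I_add]
  norm_num
  congr 1; funext z; ring

lemma V_le (h0 : 0 < ρ) (h1 : ρ ≤ 1) (n : ℕ) :
    I ρ n (fun z => (z:ℝ) ^ 2) ≤ n * I ρ n (fun _ => 1) := by
  induction n with
  | zero => simp [I_zero]
  | succ n ih =>
    rw [V_succ, T_succ]
    have := sk_nonneg h0 h1 n
    push_cast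
    nlinarith [(Nat.cast_nonneg n : (0:ℝ) ≤ n)]

lemma I_dirac (n : ℕ) : I ρ n (fun z => if z = 0 then 1 else 0) = Q ρ n 0 := by
  simp [I]

lemma M_succ (n : ℕ) : I ρ (n + 1) (fun z => |(z:ℝ)|) = I ρ n (fun z => |(z:ℝ)|) + Q ρ n 0 := by
  rw [I_succ, ← I_dirac, ← I_add]
  norm_num
  congr 1; funext z
  rcases lt_trichotomy z 0 with h | h | h
  · have h' : (z:ℝ) ≤ -1 := by exact_mod_cast (by omega : z ≤ -1)
    rw [if_neg h.ne, abs_of_nonpos (by linarith), abs_of_nonpos (by linarith),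
      abs_of_nonpos (by linarith)]
    ring
  · subst h; norm_num
  · have h' : (1:ℝ) ≤ z := by exact_mod_cast (by omega : 1 ≤ z)
    rw [if_neg h.ne', abs_of_nonneg (by linarith), abs_of_nonneg (by linarith),
      abs_of_nonneg (by linarith)]
    ring

lemma M_ge (h0 : 0 < ρ) (h1 : ρ ≤ 1) (n : ℕ) :
    (n:ℝ) - 1 ≤ I ρ n (fun z => |(z:ℝ)|) + I ρ n (fun _ => 1) / ρ := by
  have key : ∀ n : ℕ, (n:ℝ) ≤ I ρ (n + 1) (fun z => |(z:ℝ)|) + I ρ n (fun _ => 1) / ρ := by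
    intro n
    induction n with
    | zero => rw [M_succ]; simp [I_zero, Q, B]
    | succ n ih =>
      rw [M_succ, T_succ]
      have hq : 1 ≤ Q ρ (n + 1) 0 + sk ρ n / ρ := by
        have hs : sk ρ n / ρ = (B ρ n 1 + B ρ n (-1)) / 2 := by
          unfold sk; field_simp
        have := sk_nonneg h0 h1 n
        rw [hs]
        simp only [Q, B, if_true, zero_add]
        unfold sk at this
        linarith
      push_cast
      rw [add_div]
      linarith
  cases n with
  | zero => simp [I_zero]
  | succ n =>
    have := key n
    rw [T_succ, add_div]
    have h2 : 0 ≤ sk ρ n / ρ := div_nonneg (sk_nonneg h0 h1 n) h0.le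
    push_cast
    linarith

lemma T_ge (h0 : 0 < ρ) (h1 : ρ ≤ 1) (n : ℕ) (hn : 1 ≤ n) :
    (n:ℝ) - 1 ≤ I ρ n (fun _ => 1) * (√n + 1 / ρ) := by
  have hn' : (1:ℝ) ≤ n := by exact_mod_cast hn
  have hq : (1:ℝ) ≤ √n := Real.one_le_sqrt.2 hn'
  have hq2 : √(n:ℝ) * √n = n := Real.mul_self_sqrt (by linarith)
  have hM := M_ge h0 h1 n
  have hV := V_le h0 h1 n
  set q := √(n:ℝ)
  have hq0 : 0 < q := by linarith
  have h3 : I ρ n (fun z => |(z:ℝ)|) ≤ I ρ n (fun z => q / 2 * 1 + 1 / (2 * q) * (z:ℝ) ^ 2) := by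
    apply I_mono h0 h1
    intro z
    have : q / 2 * 1 + 1 / (2 * q) * (z:ℝ) ^ 2 - |(z:ℝ)| = 1 / (2 * q) * (q - |(z:ℝ)|) ^ 2 := by
      rw [← sq_abs (z:ℝ)]; field_simp; ring
    have : 0 ≤ 1 / (2 * q) * (q - |(z:ℝ)|) ^ 2 := by positivity
    linarith
  rw [I_add, I_smul ρ n (q / 2), I_smul ρ n (1 / (2 * q))] at h3
  have h4 : 1 / (2 * q) * I ρ n (fun z => (z:ℝ) ^ 2) ≤ q / 2 * I ρ n (fun _ => 1) := by
    calc _ ≤ 1 / (2 * q) * (n * I ρ n (fun _ => 1)) := by gcongr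
      _ = _ := by rw [← hq2]; field_simp
  rw [mul_add, mul_one_div]
  linarith

end

lemma T_eq (ρ : ℝ) (n : ℕ) :
    I ρ n (fun _ => 1) = ∑ z ∈ Finset.Icc (-(n:ℤ)) n, Q ρ n z := by
  simp only [I, mul_one]
  apply tsum_eq_sum
  intro z hz
  apply Q_supp
  by_contra h
  push Not at h
  rw [abs_lt] at h
  exact hz (Finset.mem_Icc.2 ⟨h.1.le, h.2.le⟩)

lemma dist_ge (x y : L) (s : Finset ℤ) :
    ∑ z ∈ s, (1 / 2 + (-1 / 2) * (chi (lamp x z) * chi (lamp y z))) ≤ (wordDist S x y : ℝ) := by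
  classical
  have h := le_wordDist x y (s.filter fun z => lamp x z ≠ lamp y z) (by
    intro z hz; exact (Finset.mem_filter.1 hz).2)
  have h2 : ∀ z, (1 / 2 + (-1 / 2) * (chi (lamp x z) * chi (lamp y z)))
      = if lamp x z ≠ lamp y z then (1:ℝ) else 0 := by
    intro z
    have hh : ∀ a : ZMod 2, a = 0 ∨ a = 1 := by decide
    rcases hh (lamp x z) with h | h <;> rcases hh (lamp y z) with h' | h' <;>
      rw [h, h'] <;> norm_num [chi]
  simp only [h2]
  rw [Finset.sum_boole]
  exact_mod_cast h

lemma lower {ρ : ℝ} (h0 : 0 < ρ) (h1 : ρ ≤ 1) (n : ℕ) :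
    I ρ n (fun _ => 1) / 2 ≤ iterE (Eno ρ) n (fun p => (wordDist S p.1 p.2 : ℝ)) := by
  have hE := (exp_no h0.le h1).iter n
  have h := hE.mono _ _ (fun p : L × L => dist_ge p.1 p.2 (Finset.Icc (-(n:ℤ)) n))
  refine le_trans ?_ h
  rw [hE.sum, T_eq, Finset.sum_div]
  apply Finset.sum_le_sum
  intro z _
  rw [hE.add, hE.const, hE.smul]
  have := (le_abs_self _).trans (A_bound h0.le h1 n z z)
  unfold Q
  linarith

lemma lower_sqrt {ρ : ℝ} (h0 : 0 < ρ) (h1 : ρ ≤ 1) (n : ℕ) (hn : 2 ≤ n) (hρ : 1 / ρ ≤ √n) :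
    √n / 8 ≤ iterE (Eno ρ) n (fun p => (wordDist S p.1 p.2 : ℝ)) := by
  have hl := lower h0 h1 n
  have ht := T_ge h0 h1 n (by omega)
  have hn' : (2:ℝ) ≤ n := by exact_mod_cast hn
  have hq : (1:ℝ) ≤ √n := Real.one_le_sqrt.2 (by linarith)
  have hq2 : √(n:ℝ) * √n = n := Real.mul_self_sqrt (by linarith)
  have hT : 0 ≤ I ρ n (fun _ => 1) := by
    rw [T_eq]; exact Finset.sum_nonneg fun z _ => Q_nonneg h0 h1 n z
  set q := √(n:ℝ)
  have h2 : (n:ℝ) / 2 ≤ I ρ n (fun _ => 1) * (2 * q) := by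
    nlinarith [mul_le_mul_of_nonneg_left hρ hT]
  have h3 : q / 4 ≤ I ρ n (fun _ => 1) := by
    by_contra hc
    push Not at hc
    nlinarith
  linarith

lemma avg_eq (ρ : ℝ) (n : ℕ) : avgDist S (convPow (noise muSWS ρ) n)
    = iterE (Eno ρ) n (fun p => (wordDist S p.1 p.2 : ℝ)) :=
  ((rep_noise ρ).convPow n).tsum_eq _

lemma spread_eq (n : ℕ) : spread S (convPow muSWS n)
    = iterE (Eno 1) n (fun p => (wordDist S p.1 p.2 : ℝ)) := by
  rw [iter_one]
  exact ((rep_mu.convPow n).prodM (rep_mu.convPow n)).tsum_eq fun p => (wordDist S p.1 p.2 : ℝ)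

/-- The lamplighter group with the switch-walk-switch
measure is partially noise sensitive in average word distance for the
generating set `{(0,1), (0,-1), (δ,0)}`. -/
theorem lamplighter_partially_avgDistNS :
    ∃ c > (0 : ℝ), ∀ ρ ∈ Set.Ioo (0 : ℝ) 1,
      c ≤ Filter.liminf
        (fun n => avgDist ({lampRight, lampLeft, lampDelta} : Set Lamplighter)
            (convPow (noise muSWS ρ) n) /
          spread ({lampRight, lampLeft, lampDelta} : Set Lamplighter)
            (convPow muSWS n)) atTop := by
  refine ⟨1 / 336, by norm_num, ?_⟩
  rintro ρ ⟨h0, h1⟩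
  change _ ≤ Filter.liminf (fun n => avgDist S (convPow (noise muSWS ρ) n) /
    spread S (convPow muSWS n)) atTop
  have hev : ∀ᶠ n : ℕ in atTop, 2 ≤ n ∧ 1 / ρ ≤ √(n:ℝ) :=
    (eventually_ge_atTop 2).and
      ((Real.tendsto_sqrt_atTop.comp tendsto_natCast_atTop_atTop).eventually_ge_atTop (1 / ρ))
  have hb : ∀ᶠ n : ℕ in atTop, 1 / 336 ≤ avgDist S (convPow (noise muSWS ρ) n) /
      spread S (convPow muSWS n) ∧ avgDist S (convPow (noise muSWS ρ) n) /
      spread S (convPow muSWS n) ≤ 336 := by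
    filter_upwards [hev] with n hn
    obtain ⟨hn, hq⟩ := hn
    rw [avg_eq, spread_eq]
    have hq1 : (1:ℝ) ≤ √n := Real.one_le_sqrt.2 (by exact_mod_cast (by omega : 1 ≤ n))
    have a1 := lower_sqrt h0 h1.le n hn hq
    have a2 := upper h0.le h1.le n (by omega)
    have b1 := lower_sqrt one_pos le_rfl n hn (by simpa using hq1)
    have b2 := upper zero_le_one le_rfl n (by omega)
    have hpos : 0 < iterE (Eno 1) n (fun p => (wordDist S p.1 p.2 : ℝ)) := by linarith
    constructor
    · rw [le_div_iff₀ hpos]; linarith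
    · rw [div_le_iff₀ hpos]; linarith
  refine le_liminf_of_le ?_ (hb.mono fun n h => h.1)
  exact (isBoundedUnder_of_eventually_le (hb.mono fun n h => h.2)).isCoboundedUnder_ge

end NS
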